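/- If (F, D) is a duality pair of Δ-structures, then F is homomorphically equivalent to a Δ-tree. Conversely, if F is a Δ-tree with more than one vertex, then there exists a Δ-structure D, unique up to homomorphic equivalence, such that (F, D) is a duality pair. -/

import Mathlib

/-! Framework: finite relational structures of a fixed type Δ = (δ i : i ∈ I),
homomorphisms, cores, sums, products, exponentials, shadows, trees, forests,
duality pairs, finite dualities, transversals, antichains. -/

namespace ThesisFormal

/-- A finite relational structure of type `Δ = (δ i : i ∈ I)`:
a finite nonempty base set together with a `δ i`-ary relation for each `i ∈ I`. -/
structure RelStruct (I : Type) (δ : I → ℕ) : Type 1 where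
  carrier : Type
  finite : Finite carrier
  nonempty : Nonempty carrier
  rel : ∀ i : I, Set ((Fin (δ i)) → carrier)

namespace RelStruct

variable {I : Type} {δ : I → ℕ}

/-- `f` is a homomorphism from `A` to `B`. -/
def IsHom (A B : RelStruct I δ) (f : A.carrier → B.carrier) : Prop :=
  ∀ i : I, ∀ e ∈ A.rel i, (f ∘ e) ∈ B.rel i

/-- `A → B`: some homomorphism from `A` to `B` exists. -/
def HomTo (A B : RelStruct I δ) : Prop := ∃ f, IsHom A B f

/-- `A ≈ B`: homomorphic equivalence. -/
def HomEquiv (A B : RelStruct I δ) : Prop := HomTo A B ∧ HomTo B A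

/-- `A` and `B` are incomparable: no homomorphism either way. -/
def Incomparable (A B : RelStruct I δ) : Prop := ¬ HomTo A B ∧ ¬ HomTo B A

/-- `A ≅ B`: a bijective homomorphism whose inverse is also a homomorphism. -/
def Isomorphic (A B : RelStruct I δ) : Prop :=
  ∃ f : A.carrier ≃ B.carrier, IsHom A B f ∧ IsHom B A f.symm

/-- A retraction of `A`: an endomorphism fixing its image pointwise. -/
def IsRetraction (A : RelStruct I δ) (f : A.carrier → A.carrier) : Prop :=
  IsHom A A f ∧ ∀ x ∈ Set.range f, f x = x

/-- A core: a structure with no proper retracts (every retraction is surjective). -/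
def IsCore (A : RelStruct I δ) : Prop :=
  ∀ f, IsRetraction A f → Function.Surjective f

/-- The substructure of `A` induced by a nonempty `S ⊆ |A|`. -/
noncomputable def Substruct (A : RelStruct I δ) (S : Set A.carrier) (hS : S.Nonempty) :
    RelStruct I δ where
  carrier := S
  finite := by haveI := A.finite; exact Subtype.finite
  nonempty := hS.to_subtype
  rel i := {e | (fun j => (e j : A.carrier)) ∈ A.rel i}

/-- `C` is a retract of `A`: the substructure induced by the image of a retraction. -/
def IsRetractOf (C A : RelStruct I δ) : Prop :=
  ∃ f, IsRetraction A f ∧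
    C = A.Substruct (Set.range f) ⟨f A.nonempty.some, Set.mem_range_self _⟩

/-- The sum (disjoint union) `A + B`. -/
noncomputable def sum (A B : RelStruct I δ) : RelStruct I δ where
  carrier := A.carrier ⊕ B.carrier
  finite := by haveI := A.finite; haveI := B.finite; infer_instance
  nonempty := ⟨Sum.inl A.nonempty.some⟩
  rel i := {e | (∃ ea ∈ A.rel i, e = Sum.inl ∘ ea) ∨ (∃ eb ∈ B.rel i, e = Sum.inr ∘ eb)}

/-- The product `A × B`. -/
noncomputable def prod (A B : RelStruct I δ) : RelStruct I δ where
  carrier := A.carrier × B.carrier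
  finite := by haveI := A.finite; haveI := B.finite; infer_instance
  nonempty := ⟨(A.nonempty.some, B.nonempty.some)⟩
  rel i := {e | (fun j => (e j).1) ∈ A.rel i ∧ (fun j => (e j).2) ∈ B.rel i}

/-- The exponential structure `C ^ B`. -/
noncomputable def exp (C B : RelStruct I δ) : RelStruct I δ where
  carrier := B.carrier → C.carrier
  finite := by haveI := B.finite; haveI := C.finite; infer_instance
  nonempty := ⟨fun _ => C.nonempty.some⟩
  rel i := {f | ∀ e ∈ B.rel i, (fun j => f j (e j)) ∈ C.rel i}

/-- The sum of a finite nonempty family of structures. -/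
noncomputable def sigmaSum {J : Type} (hJfin : Finite J) (hJne : Nonempty J)
    (A : J → RelStruct I δ) : RelStruct I δ where
  carrier := Σ j, (A j).carrier
  finite := by
    haveI := hJfin
    haveI : ∀ j, Finite ((A j).carrier) := fun j => (A j).finite
    infer_instance
  nonempty := ⟨⟨hJne.some, (A hJne.some).nonempty.some⟩⟩
  rel i := {e | ∃ j, ∃ ea ∈ (A j).rel i, e = fun k => ⟨j, ea k⟩}

/-- The product of a finite family of structures. -/
noncomputable def piProd {J : Type} (hJfin : Finite J)
    (A : J → RelStruct I δ) : RelStruct I δ where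
  carrier := ∀ j, (A j).carrier
  finite := by
    haveI := hJfin
    haveI : ∀ j, Finite ((A j).carrier) := fun j => (A j).finite
    infer_instance
  nonempty := ⟨fun j => (A j).nonempty.some⟩
  rel i := {e | ∀ j, (fun k => e k j) ∈ (A j).rel i}

/-- An edge of the shadow multigraph `Sh(A)`: one edge joining `e j` and `e (j+1)`
for each edge `e ∈ R i (A)` and each `j` with `j + 1 < δ i`. -/
structure ShadowEdge (A : RelStruct I δ) : Type where
  i : I
  e : Fin (δ i) → A.carrier
  mem : e ∈ A.rel i
  j : ℕ
  hj : j + 1 < δ i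

/-- First endpoint of a shadow edge. -/
def ShadowEdge.src {A : RelStruct I δ} (s : ShadowEdge A) : A.carrier :=
  s.e ⟨s.j, Nat.lt_of_succ_lt s.hj⟩

/-- Second endpoint of a shadow edge. -/
def ShadowEdge.tgt {A : RelStruct I δ} (s : ShadowEdge A) : A.carrier :=
  s.e ⟨s.j + 1, s.hj⟩

/-- The adjacency relation of the shadow `Sh(A)`. -/
def shadowAdj (A : RelStruct I δ) (a b : A.carrier) : Prop :=
  ∃ s : ShadowEdge A, (s.src = a ∧ s.tgt = b) ∨ (s.src = b ∧ s.tgt = a)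

/-- The shadow of `A` is connected. -/
def ShadowConnected (A : RelStruct I δ) : Prop :=
  ∀ a b : A.carrier, Relation.ReflTransGen (shadowAdj A) a b

/-- `A` is a Δ-tree: its shadow multigraph is a tree, i.e. it is connected and
the number of edge occurrences is one less than the number of vertices
(this rules out cycles, loops and parallel edges). -/
def IsTreeStruct (A : RelStruct I δ) : Prop :=
  ShadowConnected A ∧ Nat.card (ShadowEdge A) + 1 = Nat.card A.carrier

/-- The number of connected components of the shadow of `A`. -/
noncomputable def numComponents (A : RelStruct I δ) : ℕ :=
  Nat.card (Quot (shadowAdj A))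

/-- `A` is a Δ-forest: every component of its shadow multigraph is a tree. -/
def IsForestStruct (A : RelStruct I δ) : Prop :=
  Nat.card (ShadowEdge A) + numComponents A = Nat.card A.carrier

/-- The component of `A` containing the vertex `a`. -/
noncomputable def componentOf (A : RelStruct I δ) (a : A.carrier) : RelStruct I δ :=
  A.Substruct {b | Relation.ReflTransGen (shadowAdj A) a b}
    ⟨a, Relation.ReflTransGen.refl⟩

/-- `(F, D)` is a duality pair: for every `A`, `F → A` iff `A ↛ D`. -/
def DualityPair (F D : RelStruct I δ) : Prop :=
  ∀ A : RelStruct I δ, HomTo F A ↔ ¬ HomTo A D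

/-- `(F, D)` is a finite homomorphism duality: `F` and `D` are finite sets of
pairwise incomparable cores and for every `X`, some member of `F` maps to `X`
iff `X` maps to no member of `D`. -/
def FiniteDuality (F D : Set (RelStruct I δ)) : Prop :=
  F.Finite ∧ D.Finite ∧
  (∀ A ∈ F, IsCore A) ∧ (∀ A ∈ D, IsCore A) ∧
  F.Pairwise Incomparable ∧ D.Pairwise Incomparable ∧
  ∀ X : RelStruct I δ, (∃ A ∈ F, HomTo A X) ↔ (∀ B ∈ D, ¬ HomTo X B)

/-- The set of connected components of `A`. -/
def componentsSet (A : RelStruct I δ) : Set (RelStruct I δ) :=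
  {C | ∃ a : A.carrier, C = componentOf A a}

/-- The set `ℱ_c` of connected components of the members of `F`. -/
def componentsOfFamily (F : Set (RelStruct I δ)) : Set (RelStruct I δ) :=
  ⋃ A ∈ F, componentsSet A

/-- A quasitransversal over `F`: a set of pairwise incomparable components of
members of `F` supporting `F`. -/
def Quasitransversal (F M : Set (RelStruct I δ)) : Prop :=
  M ⊆ componentsOfFamily F ∧ M.Pairwise Incomparable ∧
  ∀ A ∈ F, ∃ C ∈ M, HomTo C A

/-- The order on quasitransversals: `M ⪯ M'` iff every member of `M'` admits a
homomorphism from some member of `M`. -/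
def QTle (M M' : Set (RelStruct I δ)) : Prop :=
  ∀ C' ∈ M', ∃ C ∈ M, HomTo C C'

/-- A transversal: a `⪯`-maximal quasitransversal. -/
def IsTransversal (F M : Set (RelStruct I δ)) : Prop :=
  Quasitransversal F M ∧ ∀ M', Quasitransversal F M' → QTle M M' → M' = M

/-- The product of a family of structures indexed by `Fin n`. -/
noncomputable def finProd (n : ℕ) (A : Fin n → RelStruct I δ) : RelStruct I δ :=
  piProd (inferInstance : Finite (Fin n)) A

/-- `D` is (isomorphic to) `D(M)`, the core of the product of the duals `D(C)`
of the members `C` of the finite set `M`. -/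
def IsSetDual (M : Set (RelStruct I δ)) (D : RelStruct I δ) : Prop :=
  IsCore D ∧ ∃ (n : ℕ) (C DC : Fin n → RelStruct I δ),
    Function.Injective C ∧ Set.range C = M ∧
    (∀ k, IsCore (DC k) ∧ DualityPair (C k) (DC k)) ∧
    HomEquiv D (finProd n DC)

/-- `D` is the result (up to isomorphism) of the transversal construction on `F`:
its members are exactly the duals of the transversals over `F`, one for each
transversal. -/
def TransversalDualSet (F D : Set (RelStruct I δ)) : Prop :=
  (∀ d ∈ D, ∃ M, IsTransversal F M ∧ IsSetDual M d) ∧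
  (∀ M, IsTransversal F M → ∃ d ∈ D, IsSetDual M d) ∧
  (∀ d ∈ D, ∀ d' ∈ D, ∀ M : Set (RelStruct I δ),
    IsSetDual M d → IsSetDual M d' → d = d')

/-- `Q` is a maximal antichain in the homomorphism order: a set of pairwise
incomparable cores such that every structure is comparable with some member. -/
def IsMaxAntichain (Q : Set (RelStruct I δ)) : Prop :=
  (∀ A ∈ Q, IsCore A) ∧ Q.Pairwise Incomparable ∧
  ∀ X : RelStruct I δ, ∃ A ∈ Q, HomTo X A ∨ HomTo A X

/-- The maximal antichain `Q` splits. -/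
def Splits (Q : Set (RelStruct I δ)) : Prop :=
  ∃ Q₁ Q₂ : Set (RelStruct I δ), Q₁ ∪ Q₂ = Q ∧ Disjoint Q₁ Q₂ ∧
    ∀ X : RelStruct I δ, (∃ A ∈ Q₁, HomTo A X) ∨ (∃ B ∈ Q₂, HomTo X B)

/-- `A < B` in the homomorphism order. -/
def StrictHom (A B : RelStruct I δ) : Prop := HomTo A B ∧ ¬ HomTo B A

/-- (The homomorphic-equivalence class of) `Y` is a cutting point in the
homomorphism order. -/
def CuttingPoint (Y : RelStruct I δ) : Prop :=
  ∃ X Z : RelStruct I δ, StrictHom X Y ∧ StrictHom Y Z ∧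
    ∀ W : RelStruct I δ, HomTo X W → HomTo W Z → (HomTo W Y ∨ HomTo Y W)

/-- `A` has at most one edge of each kind. -/
def AtMostOneEdgePerKind (A : RelStruct I δ) : Prop :=
  ∀ i : I, ∀ e ∈ A.rel i, ∀ e' ∈ A.rel i, e = e'

end RelStruct

end ThesisFormal

namespace ThesisFormal

namespace RelStruct

variable {I : Type} {δ : I → ℕ}

theorem HomTo.refl (A : RelStruct I δ) : HomTo A A := ⟨id, fun _ _ he => he⟩

theorem IsHom.comp {A B C : RelStruct I δ} {g : B.carrier → C.carrier}
    {f : A.carrier → B.carrier} (hg : IsHom B C g) (hf : IsHom A B f) :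
    IsHom A C (g ∘ f) := fun i e he => hg i _ (hf i e he)

theorem HomTo.trans {A B C : RelStruct I δ} (hAB : HomTo A B) (hBC : HomTo B C) :
    HomTo A C := by
  obtain ⟨f, hf⟩ := hAB
  obtain ⟨g, hg⟩ := hBC
  exact ⟨g ∘ f, hg.comp hf⟩

theorem IsHom.iterate {A : RelStruct I δ} {f : A.carrier → A.carrier} (hf : IsHom A A f)
    (n : ℕ) : IsHom A A f^[n] := by
  induction n with
  | zero => exact fun _ _ he => he
  | succ n ih => exact ih.comp hf

theorem HomEquiv.refl (A : RelStruct I δ) : HomEquiv A A := ⟨HomTo.refl A, HomTo.refl A⟩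

theorem HomEquiv.trans {A B C : RelStruct I δ} (hAB : HomEquiv A B) (hBC : HomEquiv B C) :
    HomEquiv A C := ⟨hAB.1.trans hBC.1, hBC.2.trans hAB.2⟩

theorem substruct_homTo (A : RelStruct I δ) (S : Set A.carrier) (hS : S.Nonempty) :
    HomTo (A.Substruct S hS) A := ⟨Subtype.val, fun _ _ he => he⟩

theorem DualityPair.of_homEquiv {F F' D : RelStruct I δ} (h : DualityPair F D)
    (hF : HomEquiv F F') : DualityPair F' D := fun A =>
  ⟨fun hA => (h A).1 (hF.1.trans hA), fun hA => hF.2.trans ((h A).2 hA)⟩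

theorem DualityPair.not_homTo {F D : RelStruct I δ} (h : DualityPair F D) : ¬ HomTo F D :=
  (h F).1 (HomTo.refl F)

theorem DualityPair.homTo_dual {F D D' : RelStruct I δ} (h : DualityPair F D)
    (h' : DualityPair F D') : HomTo D D' := by
  by_contra hD
  exact (h D).1 ((h' D).2 hD) (HomTo.refl D)

/-- The hyperedges of `A`, of all kinds. -/
abbrev Edge (A : RelStruct I δ) : Type := Σ i, A.rel i

/-- A shadow edge is a hyperedge with a choice of two consecutive positions. -/
def shadowEdgeEquiv (A : RelStruct I δ) :
    ShadowEdge A ≃ Σ x : A.Edge, {j : ℕ // j + 1 < δ x.1} where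
  toFun s := ⟨⟨s.i, s.e, s.mem⟩, s.j, s.hj⟩
  invFun p := ⟨p.1.1, p.1.2.1, p.1.2.2, p.2.1, p.2.2⟩
  left_inv _ := rfl
  right_inv _ := rfl

theorem finite_edge [Finite I] (A : RelStruct I δ) : Finite A.Edge := by
  have := A.finite
  infer_instance

theorem finite_shadowEdge [Finite I] (A : RelStruct I δ) : Finite (ShadowEdge A) := by
  have := A.finite_edge
  have (n : ℕ) : Finite {j : ℕ // j + 1 < n} :=
    Set.Finite.to_subtype ((Set.finite_lt_nat n).subset fun j hj => Nat.lt_of_succ_lt hj)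
  exact Finite.of_equiv _ A.shadowEdgeEquiv.symm

theorem shadowAdj_symm (A : RelStruct I δ) {a b : A.carrier} (h : shadowAdj A a b) :
    shadowAdj A b a :=
  let ⟨s, hs⟩ := h
  ⟨s, hs.symm⟩

/-- A homomorphic-equivalence class representative with the fewest vertices. -/
def IsMinimal (A : RelStruct I δ) : Prop :=
  ∀ B : RelStruct I δ, HomEquiv A B → Nat.card A.carrier ≤ Nat.card B.carrier

theorem exists_isMinimal (A : RelStruct I δ) : ∃ B, HomEquiv A B ∧ IsMinimal B := by
  classical
  have h : ∃ n, ∃ B, HomEquiv A B ∧ Nat.card B.carrier = n := ⟨_, A, HomEquiv.refl A, rfl⟩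
  obtain ⟨B, hAB, hB⟩ := Nat.find_spec h
  exact ⟨B, hAB, fun C hC => hB.trans_le (Nat.find_min' h ⟨C, hAB.trans hC, rfl⟩)⟩

theorem IsMinimal.eq_univ {A : RelStruct I δ} (hA : IsMinimal A) {S : Set A.carrier}
    (hS : S.Nonempty) (h : HomTo A (A.Substruct S hS)) : S = Set.univ := by
  have := A.finite
  have hcard : Nat.card A.carrier ≤ S.ncard := hA _ ⟨h, A.substruct_homTo S hS⟩
  refine Set.eq_of_subset_of_ncard_le S.subset_univ ?_
  rwa [Set.ncard_univ]

theorem IsMinimal.bijective {A : RelStruct I δ} (hA : IsMinimal A)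
    {f : A.carrier → A.carrier} (hf : IsHom A A f) : Function.Bijective f := by
  have := A.finite
  have := A.nonempty
  refine Finite.surjective_iff_bijective.1 (Set.range_eq_univ.1 ?_)
  exact hA.eq_univ (Set.range_nonempty f) ⟨fun x => ⟨f x, x, rfl⟩, hf⟩

/-- A homomorphism onto a minimal structure that has some homomorphism back splits. -/
theorem IsMinimal.exists_section {A B : RelStruct I δ} (hA : IsMinimal A)
    {π : B.carrier → A.carrier} (hπ : IsHom B A π) (h : HomTo A B) :
    ∃ f, IsHom A B f ∧ ∀ x, π (f x) = x := by
  have := A.finite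
  obtain ⟨g, hg⟩ := h
  have hbij := hA.bijective (hπ.comp hg)
  let e := Equiv.ofBijective _ hbij
  have hn : (e ^ orderOf e) = 1 := pow_orderOf_eq_one e
  have hpos : 0 < orderOf e := orderOf_pos e
  refine ⟨g ∘ (π ∘ g)^[orderOf e - 1], hg.comp ((hπ.comp hg).iterate _), fun x => ?_⟩
  have h1 : (π ∘ g)^[orderOf e] x = x := by
    change (⇑e)^[orderOf e] x = x
    rw [Equiv.Perm.iterate_eq_pow, hn, Equiv.Perm.one_apply]
  obtain ⟨m, hm⟩ : ∃ m, orderOf e = m + 1 := ⟨_, (Nat.succ_pred_eq_of_pos hpos).symm⟩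
  rw [hm, Function.iterate_succ_apply'] at h1
  simpa [hm] using h1

/-- All entries of a hyperedge lie in the same shadow component. -/
theorem mem_iff_of_closed {A : RelStruct I δ} {S : Set A.carrier}
    (hS : ∀ a b, shadowAdj A a b → (a ∈ S ↔ b ∈ S)) {i : I} {e : Fin (δ i) → A.carrier}
    (he : e ∈ A.rel i) (k l : Fin (δ i)) : e k ∈ S ↔ e l ∈ S := by
  have key : ∀ n (hn : n < δ i), e ⟨n, hn⟩ ∈ S ↔ e ⟨0, by omega⟩ ∈ S := by
    intro n
    induction n with
    | zero => exact fun _ => Iff.rfl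
    | succ n ih =>
      intro hn
      rw [← ih (by omega)]
      exact hS _ _ ⟨⟨i, e, he, n, hn⟩, Or.inr ⟨rfl, rfl⟩⟩
  exact (key k.1 k.2).trans (key l.1 l.2).symm

theorem homTo_of_closed {A D : RelStruct I δ} (hδ : ∀ i, 0 < δ i) {S : Set A.carrier}
    (hS : ∀ a b, shadowAdj A a b → (a ∈ S ↔ b ∈ S)) (hne : S.Nonempty) (hne' : Sᶜ.Nonempty)
    (h : HomTo (A.Substruct S hne) D) (h' : HomTo (A.Substruct Sᶜ hne') D) : HomTo A D := by
  classical
  obtain ⟨f, hf⟩ := h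
  obtain ⟨g, hg⟩ := h'
  refine ⟨fun x => if hx : x ∈ S then f ⟨x, hx⟩ else g ⟨x, hx⟩, fun i e he => ?_⟩
  by_cases h0 : e ⟨0, hδ i⟩ ∈ S
  · have hall k : e k ∈ S := (mem_iff_of_closed hS he k _).2 h0
    convert hf i (fun k => ⟨e k, hall k⟩) he using 1
    funext k
    exact dif_pos (hall k)
  · have hall k : e k ∉ S := fun hk => h0 ((mem_iff_of_closed hS he k _).1 hk)
    convert hg i (fun k => ⟨e k, hall k⟩) he using 1
    funext k
    exact dif_neg (hall k)

theorem DualityPair.shadowConnected {F D : RelStruct I δ} (hδ : ∀ i, 0 < δ i)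
    (hFD : DualityPair F D) (hF : IsMinimal F) : ShadowConnected F := by
  intro a b
  by_contra hab
  let S : Set F.carrier := {c | Relation.ReflTransGen (shadowAdj F) a c}
  have hS : ∀ c d, shadowAdj F c d → (c ∈ S ↔ d ∈ S) := fun c d hcd =>
    ⟨fun hc => hc.tail hcd, fun hd => hd.tail (F.shadowAdj_symm hcd)⟩
  have hne : S.Nonempty := ⟨a, Relation.ReflTransGen.refl⟩
  have hne' : Sᶜ.Nonempty := ⟨b, hab⟩
  have key (U : Set F.carrier) (hU : U.Nonempty) (hU' : Uᶜ.Nonempty) :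
      HomTo (F.Substruct U hU) D := by
    by_contra hD
    have := hF.eq_univ hU ((hFD _).2 hD)
    simp [this] at hU'
  exact hFD.not_homTo
    (homTo_of_closed hδ hS hne hne' (key S hne hne') (key Sᶜ hne' (by simpa using hne)))

/-- Copies of `F` indexed by `Fin n`, with the shadow edge `s` redirected from each copy
to all later copies. -/
noncomputable def twist (F : RelStruct I δ) (s : ShadowEdge F) (n : ℕ) :
    RelStruct I δ where
  carrier := F.carrier × Fin (n + 1)
  finite := by
    have := F.finite
    infer_instance
  nonempty := ⟨(F.nonempty.some, 0)⟩
  rel i := {w | Prod.fst ∘ w ∈ F.rel i ∧ ∃ p q : Fin (n + 1),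
    (((⟨i, Prod.fst ∘ w⟩ : Σ i, Fin (δ i) → F.carrier) = ⟨s.i, s.e⟩ ∧ p < q) ∨
      ((⟨i, Prod.fst ∘ w⟩ : Σ i, Fin (δ i) → F.carrier) ≠ ⟨s.i, s.e⟩ ∧ p = q)) ∧
    ∀ k, (w k).2 = if k.1 ≤ s.j then p else q}

theorem not_twist_homTo {F D : RelStruct I δ} (hFD : ¬ HomTo F D) (s : ShadowEdge F)
    {n : ℕ} (hn : Nat.card (F.carrier → D.carrier) ≤ n) : ¬ HomTo (F.twist s n) D := by
  classical
  rintro ⟨φ, hφ⟩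
  have := F.finite
  have := D.finite
  let c : Fin (n + 1) → F.carrier → D.carrier := fun p x => φ (x, p)
  have hc : ¬ Function.Injective c := fun hc => by
    have := Nat.card_le_card_of_injective c hc
    rw [Nat.card_fin] at this
    omega
  obtain ⟨p, q, hpq, hlt⟩ : ∃ p q, c p = c q ∧ p < q := by
    simp only [Function.Injective, not_forall] at hc
    obtain ⟨p, q, h, hne⟩ := hc
    rcases lt_or_gt_of_ne hne with h' | h'
    · exact ⟨p, q, h, h'⟩
    · exact ⟨q, p, h.symm, h'⟩
  refine hFD ⟨c p, fun i e he => ?_⟩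
  let q' := if (⟨i, e⟩ : Σ i, Fin (δ i) → F.carrier) = ⟨s.i, s.e⟩ then q else p
  have hq' : c q' = c p := by
    dsimp only [q']
    split_ifs
    exacts [hpq.symm, rfl]
  have := hφ i (fun k => (e k, if k.1 ≤ s.j then p else q')) ⟨he, p, q', ?_, fun k => rfl⟩
  · convert this using 1
    funext k
    change c p (e k) = c (if k.1 ≤ s.j then p else q') (e k)
    split_ifs
    exacts [rfl, congrFun hq'.symm _]
  · by_cases h : (⟨i, e⟩ : Σ i, Fin (δ i) → F.carrier) = ⟨s.i, s.e⟩
    · exact Or.inl ⟨h, by simpa [q', h] using hlt⟩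
    · exact Or.inr ⟨h, by simp [q', h]⟩

/-- In a minimal structure with a dual, every shadow edge can be separated from all others. -/
theorem DualityPair.exists_potential {F D : RelStruct I δ} (hFD : DualityPair F D)
    (hF : IsMinimal F) (s : ShadowEdge F) :
    ∃ σ : F.carrier → ℕ, σ s.src ≠ σ s.tgt ∧ ∀ t, t ≠ s → σ t.src = σ t.tgt := by
  obtain ⟨f, hf, hsec⟩ := hF.exists_section (B := F.twist s _) (π := Prod.fst)
    (fun i w hw => hw.1) ((hFD _).2 (not_twist_homTo hFD.not_homTo s le_rfl))
  have hfst {i : I} (e : Fin (δ i) → F.carrier) : Prod.fst ∘ f ∘ e = e :=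
    funext fun k => hsec (e k)
  refine ⟨fun x => (f x).2, ?_, fun t hts => ?_⟩
  · obtain ⟨-, p, q, h, hk⟩ := hf s.i s.e s.mem
    erw [hfst] at h
    have hlt : p < q := by simpa using h
    have h1 := hk ⟨s.j, Nat.lt_of_succ_lt s.hj⟩
    have h2 := hk ⟨s.j + 1, s.hj⟩
    simp only [Function.comp_apply, le_refl, if_true] at h1
    simp only [Function.comp_apply, Nat.not_succ_le_self, if_false] at h2
    simp only [ShadowEdge.src, ShadowEdge.tgt, h1, h2]
    exact Nat.ne_of_lt hlt
  · obtain ⟨-, p, q, h, hk⟩ := hf t.i t.e t.mem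
    erw [hfst] at h
    have h1 := hk ⟨t.j, Nat.lt_of_succ_lt t.hj⟩
    have h2 := hk ⟨t.j + 1, t.hj⟩
    simp only [Function.comp_apply] at h1 h2
    simp only [ShadowEdge.src, ShadowEdge.tgt, h1, h2]
    rcases h with ⟨h, -⟩ | ⟨-, rfl⟩
    · have hj : t.j ≠ s.j := by
        rintro hj
        obtain ⟨i, e, m, j, hj'⟩ := t
        obtain ⟨i', e', m', j', hj''⟩ := s
        obtain ⟨rfl, h⟩ := Sigma.mk.inj h
        cases h
        cases hj
        exact hts rfl
      have : t.j ≤ s.j ↔ t.j + 1 ≤ s.j := by omega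
      simp [this]
    · simp

/-- A connected structure all of whose shadow edges can be separated is a tree. -/
theorem isTreeStruct_of_potential [Finite I] {F : RelStruct I δ} (hconn : ShadowConnected F)
    (hpot : ∀ s : ShadowEdge F,
      ∃ σ : F.carrier → ℕ, σ s.src ≠ σ s.tgt ∧ ∀ t, t ≠ s → σ t.src = σ t.tgt) :
    IsTreeStruct F := by
  classical
  have := F.finite
  have := F.nonempty
  have := Fintype.ofFinite F.carrier
  have hirr : ∀ s : ShadowEdge F, s.src ≠ s.tgt := fun s h => by
    obtain ⟨σ, hσ, -⟩ := hpot s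
    exact hσ (congrArg σ h)
  let G : SimpleGraph F.carrier :=
    { Adj := shadowAdj F
      symm := ⟨fun _ _ h => F.shadowAdj_symm h⟩
      loopless := ⟨by
        rintro a ⟨s, ⟨h, h'⟩ | ⟨h, h'⟩⟩
        all_goals exact hirr s (h.trans h'.symm)⟩ }
  have hadj (s : ShadowEdge F) : G.Adj s.src s.tgt := ⟨s, Or.inl ⟨rfl, rfl⟩⟩
  have hG : G.IsTree := by
    refine ⟨⟨fun a b => ?_⟩, ?_⟩
    · exact (SimpleGraph.reachable_iff_reflTransGen a b).2 (hconn a b)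
    · rw [SimpleGraph.isAcyclic_iff_forall_adj_isBridge]
      have key (s : ShadowEdge F) : G.IsBridge s(s.src, s.tgt) := by
        rw [SimpleGraph.isBridge_iff]
        intro hreach
        obtain ⟨σ, hσ, hσ'⟩ := hpot s
        rw [SimpleGraph.reachable_iff_reflTransGen] at hreach
        apply hσ
        have (b) (hb : Relation.ReflTransGen
            (G \ SimpleGraph.fromEdgeSet {s(s.src, s.tgt)}).Adj s.src b) : σ s.src = σ b := by
          induction hb with
          | refl => rfl
          | tail _ h ih =>
            rw [ih]
            rw [SimpleGraph.sdiff_adj] at h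
            obtain ⟨⟨t, ht⟩, h⟩ := h
            have hts : t ≠ s := by
              rintro rfl
              apply h
              rcases ht with ⟨rfl, rfl⟩ | ⟨rfl, rfl⟩
              · simpa using hirr t
              · simpa [Sym2.eq_swap] using (hirr t).symm
            rcases ht with ⟨rfl, rfl⟩ | ⟨rfl, rfl⟩
            · exact hσ' t hts
            · exact (hσ' t hts).symm
        exact this _ hreach
      rintro a b ⟨s, ⟨rfl, rfl⟩ | ⟨rfl, rfl⟩⟩
      · exact key s
      · rw [Sym2.eq_swap]
        exact key s
  refine ⟨hconn, ?_⟩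
  have hbij : Function.Bijective
      (fun s : ShadowEdge F => (⟨s(s.src, s.tgt), hadj s⟩ : G.edgeSet)) := by
    constructor
    · intro s t hst
      by_contra hne
      obtain ⟨σ, hσ, hσ'⟩ := hpot s
      have ht := hσ' t (Ne.symm hne)
      have hst : s(s.src, s.tgt) = s(t.src, t.tgt) := congrArg Subtype.val hst
      rcases Sym2.eq_iff.1 hst with ⟨h, h'⟩ | ⟨h, h'⟩
      · exact hσ (by rw [h, h', ht])
      · exact hσ (by rw [h, h', ht])
    · rintro ⟨x, hx⟩
      induction x with
      | h a b =>
        obtain ⟨s, ⟨h, h'⟩ | ⟨h, h'⟩⟩ := hx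
        · exact ⟨s, Subtype.ext (Sym2.eq_iff.2 (Or.inl ⟨h, h'⟩))⟩
        · exact ⟨s, Subtype.ext (Sym2.eq_iff.2 (Or.inr ⟨h, h'⟩))⟩
  rw [Nat.card_eq_of_bijective _ hbij, Nat.card_eq_fintype_card, Nat.card_eq_fintype_card,
    ← SimpleGraph.edgeFinset_card]
  exact hG.card_edgeFinset

theorem DualityPair.exists_tree [Finite I] (hδ : ∀ i, 0 < δ i) {F D : RelStruct I δ}
    (hFD : DualityPair F D) : ∃ T : RelStruct I δ, T.IsTreeStruct ∧ F.HomEquiv T := by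
  obtain ⟨T, hFT, hT⟩ := F.exists_isMinimal
  have hTD := hFD.of_homEquiv hFT
  exact ⟨T, isTreeStruct_of_potential (hTD.shadowConnected hδ hT) (hTD.exists_potential hT), hFT⟩

/-- A rooted presentation of a tree: each hyperedge has a `head` position closest to the root,
and each vertex other than the root occupies exactly one non-head position. -/
structure Rooting (T : RelStruct I δ) where
  root : T.carrier
  depth : T.carrier → ℕ
  head : ∀ x : T.Edge, Fin (δ x.1)
  depth_lt : ∀ x l, l ≠ head x → depth (x.2.1 (head x)) < depth (x.2.1 l)
  exists_parent : ∀ v, v ≠ root →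
    ∃ p : Σ x : T.Edge, Fin (δ x.1), p.2 ≠ head p.1 ∧ p.1.2.1 p.2 = v
  parent_unique : ∀ p q : Σ x : T.Edge, Fin (δ x.1), p.2 ≠ head p.1 → q.2 ≠ head q.1 →
    p.1.2.1 p.2 = q.1.2.1 q.2 → p = q
  ne_root : ∀ x l, l ≠ head x → x.2.1 l ≠ root

theorem exists_depth {T : RelStruct I δ} (h : ShadowConnected T) (r : T.carrier) :
    ∃ d : T.carrier → ℕ, ∀ v, v ≠ r → ∃ u, shadowAdj T v u ∧ d u < d v := by
  let G := SimpleGraph.fromRel (shadowAdj T)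
  have hG (a b : T.carrier) : G.Reachable a b := by
    have := h a b
    induction this with
    | refl => exact SimpleGraph.Reachable.refl _
    | @tail b c _ hbc ih =>
      by_cases hne : b = c
      · exact hne ▸ ih
      · exact ih.trans (SimpleGraph.Adj.reachable
          ((SimpleGraph.fromRel_adj _ _ _).2 ⟨hne, Or.inl hbc⟩))
  refine ⟨fun v => G.dist v r, fun v hv => ?_⟩
  obtain ⟨w, hw⟩ := (hG v r).exists_walk_length_eq_dist
  cases w with
  | nil => exact absurd rfl hv
  | @cons _ u _ hadj w =>
    refine ⟨u, ?_, ?_⟩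
    · rcases ((SimpleGraph.fromRel_adj _ _ _).1 hadj).2 with h | h
      · exact h
      · exact T.shadowAdj_symm h
    · change G.dist u r < G.dist v r
      have := SimpleGraph.dist_le w
      simp only [SimpleGraph.Walk.length_cons] at hw
      omega

/-- Removing one position from every hyperedge leaves at most one position per shadow edge. -/
theorem card_nonhead_le [Finite I] (T : RelStruct I δ) (head : ∀ x : T.Edge, Fin (δ x.1)) :
    Nat.card {p : Σ x : T.Edge, Fin (δ x.1) // p.2 ≠ head p.1} ≤ Nat.card (ShadowEdge T) := by
  have := T.finite_shadowEdge
  have := Finite.of_equiv _ T.shadowEdgeEquiv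
  rw [Nat.card_congr T.shadowEdgeEquiv]
  refine Nat.card_le_card_of_injective (fun p => ⟨p.1.1,
    if p.1.2 < head p.1.1 then p.1.2.1 else p.1.2.1 - 1, ?_⟩) ?_
  · obtain ⟨⟨x, l⟩, hl⟩ := p
    have hl : l.1 ≠ (head x).1 := Fin.val_ne_of_ne hl
    have := l.2
    have := (head x).2
    dsimp only
    split_ifs with h
    · rw [Fin.lt_def] at h
      omega
    · rw [Fin.lt_def] at h
      omega
  · rintro ⟨⟨x, l⟩, hl⟩ ⟨⟨y, m⟩, hm⟩ h
    obtain ⟨rfl, h⟩ := Sigma.mk.inj h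
    have h := congrArg Subtype.val (eq_of_heq h)
    have hl' : l.1 ≠ (head x).1 := Fin.val_ne_of_ne hl
    have hm' : m.1 ≠ (head x).1 := Fin.val_ne_of_ne hm
    have : l = m := by
      ext
      simp only [Fin.lt_def] at h
      split_ifs at h <;> omega
    subst this
    rfl

theorem IsTreeStruct.nonempty_rooting [Finite I] (hδ : ∀ i, 0 < δ i) {T : RelStruct I δ}
    (hT : IsTreeStruct T) : Nonempty (Rooting T) := by
  classical
  have := T.finite
  have := T.finite_edge
  obtain ⟨r⟩ := T.nonempty
  obtain ⟨d, hd⟩ := exists_depth hT.1 r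
  have hmin (x : T.Edge) : ∃ h, ∀ l, d (x.2.1 h) ≤ d (x.2.1 l) := by
    have : Nonempty (Fin (δ x.1)) := ⟨⟨0, hδ _⟩⟩
    exact Finite.exists_min fun l => d (x.2.1 l)
  choose head hhead using hmin
  let P := {p : Σ x : T.Edge, Fin (δ x.1) // p.2 ≠ head p.1}
  have hsec (v : {v // v ≠ r}) : ∃ p : P, p.1.1.2.1 p.1.2 = v ∧
      d (p.1.1.2.1 (head p.1.1)) < d v := by
    obtain ⟨v, hv⟩ := v
    obtain ⟨u, ⟨s, hs⟩, hlt⟩ := hd v hv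
    have key (l l' : Fin (δ s.i)) (hl : s.e l = v) (hl' : s.e l' = u) : ∃ p : P,
        p.1.1.2.1 p.1.2 = v ∧ d (p.1.1.2.1 (head p.1.1)) < d v := by
      have hlt' : d (s.e (head ⟨s.i, s.e, s.mem⟩)) < d v :=
        lt_of_le_of_lt (hl' ▸ hhead ⟨s.i, s.e, s.mem⟩ l') hlt
      refine ⟨⟨⟨⟨s.i, s.e, s.mem⟩, l⟩, ?_⟩, hl, hlt'⟩
      intro hlh
      change l = head ⟨s.i, s.e, s.mem⟩ at hlh
      rw [← hlh, hl] at hlt'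
      exact lt_irrefl _ hlt'
    rcases hs with ⟨h, h'⟩ | ⟨h, h'⟩
    · exact key _ _ h h'
    · exact key _ _ h' h
  choose sec hsec hsecd using hsec
  have hinj : Function.Injective sec := fun v w h => by
    ext
    rw [← hsec v, ← hsec w, h]
  have hcard : Nat.card P ≤ Nat.card {v // v ≠ r} := by
    refine (T.card_nonhead_le head).trans ?_
    have h1 : Nat.card T.carrier = Nat.card {v // v ≠ r} + 1 := by
      have := Fintype.ofFinite T.carrier
      have hpos : 0 < Fintype.card T.carrier := Fintype.card_pos_iff.2 ⟨r⟩
      simp only [Nat.card_eq_fintype_card, Fintype.card_subtype_compl, Fintype.card_subtype_eq,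
        ne_eq]
      omega
    have := hT.2
    omega
  have hbij := hinj.bijective_of_nat_card_le hcard
  have hsurj (x : T.Edge) (l) (hl : l ≠ head x) : ∃ v, (sec v).1 = ⟨x, l⟩ := by
    obtain ⟨v, hv⟩ := hbij.2 ⟨⟨x, l⟩, hl⟩
    exact ⟨v, congrArg Subtype.val hv⟩
  refine ⟨⟨r, d, head, ?_, ?_, ?_, ?_⟩⟩
  · intro x l hl
    obtain ⟨v, hv⟩ := hsurj x l hl
    have h1 := hsecd v
    rw [← hsec v, hv] at h1
    exact h1
  · exact fun v hv => ⟨_, (sec ⟨v, hv⟩).2, hsec ⟨v, hv⟩⟩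
  · rintro ⟨x, l⟩ ⟨y, m⟩ hl hm h
    obtain ⟨v, hv⟩ := hsurj x l hl
    obtain ⟨w, hw⟩ := hsurj y m hm
    have h1 := hsec v
    have h2 := hsec w
    rw [hv] at h1
    rw [hw] at h2
    have : v = w := Subtype.ext (h1.symm.trans (h.trans h2))
    rw [← hv, ← hw, this]
  · intro x l hl
    obtain ⟨v, hv⟩ := hsurj x l hl
    have h1 := hsec v
    rw [hv] at h1
    exact h1 ▸ v.2

namespace Rooting

variable {T : RelStruct I δ} (ρ : Rooting T) (A : RelStruct I δ)

/-- The hyperedge `x` can be mapped into `A` with its head at `a`, its other entries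
satisfying `S`. -/
def Step (S : T.carrier → A.carrier → Prop) (x : T.Edge) (a : A.carrier) : Prop :=
  ∃ b ∈ A.rel x.1, b (ρ.head x) = a ∧ ∀ l, l ≠ ρ.head x → S (x.2.1 l) (b l)

/-- The subtree hanging from `v` maps into `A` with `v` sent to `a`; expressed as the largest
relation closed under `Step`. -/
def Maps (v : T.carrier) (a : A.carrier) : Prop :=
  ∃ S : T.carrier → A.carrier → Prop, S v a ∧
    ∀ w c, S w c → ∀ x : T.Edge, x.2.1 (ρ.head x) = w → ρ.Step A S x c

variable {A}

theorem Step.mono {S S' : T.carrier → A.carrier → Prop} (h : ∀ v a, S v a → S' v a)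
    {x : T.Edge} {a : A.carrier} (hx : ρ.Step A S x a) : ρ.Step A S' x a := by
  obtain ⟨b, hb, hba, hS⟩ := hx
  exact ⟨b, hb, hba, fun l hl => h _ _ (hS l hl)⟩

theorem maps_iff {v : T.carrier} {a : A.carrier} :
    ρ.Maps A v a ↔ ∀ x : T.Edge, x.2.1 (ρ.head x) = v → ρ.Step A (ρ.Maps A) x a := by
  constructor
  · rintro ⟨S, hva, hS⟩ x hx
    exact Step.mono ρ (fun w c hwc => ⟨S, hwc, hS⟩) (hS v a hva x hx)
  · intro h
    refine ⟨fun w c => ρ.Maps A w c ∨ (w = v ∧ c = a), Or.inr ⟨rfl, rfl⟩, ?_⟩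
    rintro w c (⟨S, hwc, hS⟩ | ⟨rfl, rfl⟩) x hx
    · exact Step.mono ρ (fun u d hud => Or.inl ⟨S, hud, hS⟩) (hS w c hwc x hx)
    · exact Step.mono ρ (fun u d hud => Or.inl hud) (h x hx)

theorem homTo_of_maps {a : A.carrier} (h : ρ.Maps A ρ.root a) : HomTo T A := by
  classical
  have hb (x : T.Edge) (c : A.carrier) : ∃ b : Fin (δ x.1) → A.carrier,
      ρ.Step A (ρ.Maps A) x c → b ∈ A.rel x.1 ∧ b (ρ.head x) = c ∧
        ∀ l, l ≠ ρ.head x → ρ.Maps A (x.2.1 l) (b l) := by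
    by_cases hx : ρ.Step A (ρ.Maps A) x c
    · obtain ⟨b, hb⟩ := hx
      exact ⟨b, fun _ => hb⟩
    · exact ⟨fun _ => c, fun h => absurd h hx⟩
  choose b hb using hb
  choose par hpar hpar' using ρ.exists_parent
  have hwf : WellFounded fun v w => ρ.depth v < ρ.depth w := (measure ρ.depth).wf
  have hlt (v) (hv : v ≠ ρ.root) :
      ρ.depth ((par v hv).1.2.1 (ρ.head (par v hv).1)) < ρ.depth v := by
    have := ρ.depth_lt _ _ (hpar v hv)
    rwa [hpar' v hv] at this
  let g : T.carrier → A.carrier := hwf.fix fun v ih =>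
    if hv : v = ρ.root then a else b (par v hv).1 (ih _ (hlt v hv)) (par v hv).2
  have hg (v) : g v = if hv : v = ρ.root then a else
      b (par v hv).1 (g ((par v hv).1.2.1 (ρ.head (par v hv).1))) (par v hv).2 :=
    hwf.fix_eq _ v
  have hmaps (v) : ρ.Maps A v (g v) := by
    induction v using hwf.induction with
    | _ v ih =>
      rw [hg]
      split_ifs with hv
      · exact hv ▸ h
      · have := (hb _ _ ((ρ.maps_iff).1 (ih _ (hlt v hv)) _ rfl)).2.2 _ (hpar v hv)
        rwa [hpar' v hv] at this
  refine ⟨g, fun i e he => ?_⟩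
  let x : T.Edge := ⟨i, e, he⟩
  obtain ⟨hmem, hhead, -⟩ := hb x _ ((ρ.maps_iff).1 (hmaps (e (ρ.head x))) x rfl)
  convert hmem using 1
  funext l
  by_cases hl : l = ρ.head x
  · rw [hl]
    exact hhead.symm
  · have hv : e l ≠ ρ.root := ρ.ne_root x l hl
    have hp : par (e l) hv = ⟨x, l⟩ := ρ.parent_unique _ _ (hpar _ hv) hl (hpar' _ hv)
    change g (e l) = _
    rw [hg, dif_neg hv, hp]

end Rooting

/-- The dual of a tree `T`: its vertices choose a hyperedge at every vertex of `T`. -/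
noncomputable def treeDual [Finite I] (T : RelStruct I δ)
    (hT : ∀ v, ∃ x : T.Edge, ∃ l, x.2.1 l = v) : RelStruct I δ where
  carrier := {f : T.carrier → T.Edge // ∀ v, ∃ l, (f v).2.1 l = v}
  finite := by
    have := T.finite
    have := T.finite_edge
    infer_instance
  nonempty := ⟨⟨fun v => (hT v).choose, fun v => (hT v).choose_spec⟩⟩
  rel i := {f | ∀ e : T.rel i, ∃ l, (f l).1 (e.1 l) ≠ ⟨i, e⟩}

namespace Rooting

variable [Finite I] {T : RelStruct I δ} (ρ : Rooting T)
  (hT : ∀ v, ∃ x : T.Edge, ∃ l, x.2.1 l = v)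

include ρ in
theorem not_homTo_treeDual : ¬ HomTo T (T.treeDual hT) := by
  rintro ⟨φ, hφ⟩
  have := T.finite
  let g (v : T.carrier) : T.Edge := (φ v).1 v
  have hg (v) : ∃ l, (g v).2.1 l = v := (φ v).2 v
  let S := {v : T.carrier | (g v).2.1 (ρ.head (g v)) = v}
  have hroot : ρ.root ∈ S := by
    obtain ⟨l, hl⟩ := hg ρ.root
    by_cases h : l = ρ.head (g ρ.root)
    · rw [h] at hl
      exact hl
    · exact absurd hl (ρ.ne_root _ l h)
  obtain ⟨v, hvS, hmax⟩ := Set.exists_max_image S ρ.depth S.toFinite ⟨_, hroot⟩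
  obtain ⟨l, hl⟩ := hφ _ _ (g v).2.2 (g v).2
  change g ((g v).2.1 l) ≠ g v at hl
  have hlh : l ≠ ρ.head (g v) := by
    rintro rfl
    exact hl (congrArg g hvS)
  have hlt := ρ.depth_lt _ _ hlh
  rw [hvS] at hlt
  refine absurd (hmax ((g v).2.1 l) ?_) (not_le.2 hlt)
  obtain ⟨m, hm⟩ := hg ((g v).2.1 l)
  by_cases h : m = ρ.head (g ((g v).2.1 l))
  · rw [h] at hm
    exact hm
  · have := ρ.parent_unique ⟨_, m⟩ ⟨_, l⟩ h hlh hm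
    exact absurd (congrArg Sigma.fst this) hl

include ρ in
theorem homTo_treeDual {A : RelStruct I δ} (hA : ¬ HomTo T A) :
    HomTo A (T.treeDual hT) := by
  have hchoice (a : A.carrier) (v : T.carrier) : ∃ x : T.Edge, (∃ l, x.2.1 l = v) ∧
      ((x.2.1 (ρ.head x) = v ∧ ¬ ρ.Step A (ρ.Maps A) x a) ∨
        (ρ.Maps A v a ∧ ∃ l, l ≠ ρ.head x ∧ x.2.1 l = v)) := by
    by_cases h : ρ.Maps A v a
    · have hv : v ≠ ρ.root := by
        rintro rfl
        exact hA (ρ.homTo_of_maps h)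
      obtain ⟨p, hp, hpv⟩ := ρ.exists_parent v hv
      exact ⟨p.1, ⟨_, hpv⟩, Or.inr ⟨h, _, hp, hpv⟩⟩
    · have h' := h
      rw [ρ.maps_iff] at h'
      push Not at h'
      obtain ⟨x, hx, hstep⟩ := h'
      exact ⟨x, ⟨_, hx⟩, Or.inl ⟨hx, hstep⟩⟩
  choose f hf hf' using hchoice
  refine ⟨fun a => ⟨f a, hf a⟩, fun i w hw e => ?_⟩
  by_contra! hall
  let x : T.Edge := ⟨i, e⟩
  have hall (l) : f (w l) (e.1 l) = x := hall l
  have hhead : ¬ ρ.Step A (ρ.Maps A) x (w (ρ.head x)) := by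
    have := hf' (w (ρ.head x)) (e.1 (ρ.head x))
    rw [hall] at this
    rcases this with ⟨-, h⟩ | ⟨-, l, hl, hl'⟩
    · exact h
    · have hlt := ρ.depth_lt x l hl
      rw [hl'] at hlt
      exact absurd hlt (lt_irrefl _)
  refine hhead ⟨w, hw, rfl, fun l hl => ?_⟩
  have := hf' (w l) (e.1 l)
  rw [hall] at this
  rcases this with ⟨h, -⟩ | ⟨h, -⟩
  · have hlt := ρ.depth_lt x l hl
    rw [h] at hlt
    exact absurd hlt (lt_irrefl _)
  · exact h

include ρ in
theorem dualityPair_treeDual : DualityPair T (T.treeDual hT) := fun _ =>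
  ⟨fun h h' => ρ.not_homTo_treeDual hT (h.trans h'),
    fun h => by_contra fun h' => h (ρ.homTo_treeDual hT h')⟩

end Rooting

theorem ShadowConnected.exists_edge {T : RelStruct I δ} (hT : ShadowConnected T)
    (hcard : 1 < Nat.card T.carrier) (v : T.carrier) : ∃ x : T.Edge, ∃ l, x.2.1 l = v := by
  have := T.finite
  have : Nontrivial T.carrier := Finite.one_lt_card_iff_nontrivial.1 hcard
  obtain ⟨u, hu⟩ := exists_ne v
  rcases Relation.ReflTransGen.cases_head (hT v u) with h | ⟨c, ⟨s, hs⟩, -⟩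
  · exact absurd h.symm hu
  · rcases hs with ⟨h, -⟩ | ⟨-, h⟩
    · exact ⟨⟨s.i, s.e, s.mem⟩, _, h⟩
    · exact ⟨⟨s.i, s.e, s.mem⟩, _, h⟩

end RelStruct

end ThesisFormal

open ThesisFormal RelStruct in
/-- If `(F, D)` is a duality pair then `F` is homomorphically
equivalent to a Δ-tree. Conversely, if `F` is a Δ-tree with more than one
vertex, then there is a Δ-structure `D`, unique up to homomorphic
equivalence, such that `(F, D)` is a duality pair. -/
theorem stmt_9 {I : Type} [Finite I] {δ : I → ℕ} (hδ : ∀ i, 2 ≤ δ i) :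
    (∀ F D : RelStruct I δ, DualityPair F D →
      ∃ T : RelStruct I δ, T.IsTreeStruct ∧ F.HomEquiv T) ∧
    (∀ F : RelStruct I δ, F.IsTreeStruct → 1 < Nat.card F.carrier →
      ∃ D : RelStruct I δ, DualityPair F D ∧
        ∀ D' : RelStruct I δ, DualityPair F D' → D.HomEquiv D') := by
  have hpos i : 0 < δ i := lt_of_lt_of_le two_pos (hδ i)
  refine ⟨fun F D hFD => hFD.exists_tree hpos, fun F hF hcard => ?_⟩
  obtain ⟨ρ⟩ := hF.nonempty_rooting hpos
  have hD := ρ.dualityPair_treeDual (hF.1.exists_edge hcard)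
  exact ⟨_, hD, fun D' hD' => ⟨hD.homTo_dual hD', hD'.homTo_dual hD⟩⟩
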